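/- With the data below, let f : M → A be a k-linear map such that f(M) ⊆ Z(ˢA), f is left H-linear (f(h·m) = ρ(h⊗f(m))), and f(m·h) = ε(h)f(m). Let V ⊆ M be a k-subspace such that φ(V⊗A) ⊆ A⊗V. Then the set A_{f,V} := {a ∈ A : f(v)·a = (μ_A∘(A⊗f)∘φ)(v⊗a) for all v ∈ V} is a subalgebra of A. -/

import Mathlib

open TensorProduct LinearMap

noncomputable section

variable {k H A M : Type*} [Field k] [Semiring H] [HopfAlgebra k H]
  [Ring A] [Algebra k A] [AddCommGroup M] [Module k M]

/-- `H` is cocommutative: `τ∘Δ = Δ`. -/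
def HopfCocomm (k H : Type*) [Field k] [Semiring H] [HopfAlgebra k H] : Prop :=
  (TensorProduct.comm k H H).toLinearMap ∘ₗ Coalgebra.comul (R := k) = Coalgebra.comul (R := k)

/-- `s : H⊗A → A⊗H` is a left transposition of `H` on `A` (braid of `H` the flip). -/
structure IsTransposition (s : H ⊗[k] A →ₗ[k] A ⊗[k] H) : Prop where
  bij : Function.Bijective s
  one_left : ∀ a : A, s ((1 : H) ⊗ₜ[k] a) = a ⊗ₜ[k] (1 : H)
  mul_H : s ∘ₗ rTensor A (LinearMap.mul' k H) =
    lTensor A (LinearMap.mul' k H) ∘ₗ (TensorProduct.assoc k A H H).toLinearMap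
      ∘ₗ rTensor H s ∘ₗ (TensorProduct.assoc k H A H).symm.toLinearMap
      ∘ₗ lTensor H s ∘ₗ (TensorProduct.assoc k H H A).toLinearMap
  counit : (TensorProduct.rid k A).toLinearMap ∘ₗ lTensor A (Coalgebra.counit (R := k)) ∘ₗ s =
    (TensorProduct.lid k A).toLinearMap ∘ₗ rTensor A (Coalgebra.counit (R := k))
  comul : lTensor A (Coalgebra.comul (R := k)) ∘ₗ s =
    (TensorProduct.assoc k A H H).toLinearMap ∘ₗ rTensor H s
      ∘ₗ (TensorProduct.assoc k H A H).symm.toLinearMap ∘ₗ lTensor H s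
      ∘ₗ (TensorProduct.assoc k H H A).toLinearMap ∘ₗ rTensor A (Coalgebra.comul (R := k))
  braid : (TensorProduct.assoc k A H H).toLinearMap ∘ₗ rTensor H s
      ∘ₗ (TensorProduct.assoc k H A H).symm.toLinearMap ∘ₗ lTensor H s
      ∘ₗ (TensorProduct.assoc k H H A).toLinearMap
      ∘ₗ rTensor A (TensorProduct.comm k H H).toLinearMap =
    lTensor A (TensorProduct.comm k H H).toLinearMap
      ∘ₗ (TensorProduct.assoc k A H H).toLinearMap ∘ₗ rTensor H s
      ∘ₗ (TensorProduct.assoc k H A H).symm.toLinearMap ∘ₗ lTensor H s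
      ∘ₗ (TensorProduct.assoc k H H A).toLinearMap
  one_right : ∀ h : H, s (h ⊗ₜ[k] (1 : A)) = (1 : A) ⊗ₜ[k] h
  mul_A : s ∘ₗ lTensor H (LinearMap.mul' k A) =
    rTensor H (LinearMap.mul' k A) ∘ₗ (TensorProduct.assoc k A A H).symm.toLinearMap
      ∘ₗ lTensor A s ∘ₗ (TensorProduct.assoc k A H A).toLinearMap
      ∘ₗ rTensor A s ∘ₗ (TensorProduct.assoc k H A A).symm.toLinearMap

/-- `(A, s)` is a left `H`-module algebra with action `ρ`. -/
structure IsModuleAlgebra (s : H ⊗[k] A →ₗ[k] A ⊗[k] H) (ρ : H ⊗[k] A →ₗ[k] A) : Prop where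
  one_smul : ∀ a : A, ρ ((1 : H) ⊗ₜ[k] a) = a
  mul_smul : ρ ∘ₗ rTensor A (LinearMap.mul' k H) =
    ρ ∘ₗ lTensor H ρ ∘ₗ (TensorProduct.assoc k H H A).toLinearMap
  s_compat : s ∘ₗ lTensor H ρ =
    rTensor H ρ ∘ₗ (TensorProduct.assoc k H A H).symm.toLinearMap ∘ₗ lTensor H s
      ∘ₗ (TensorProduct.assoc k H H A).toLinearMap
      ∘ₗ rTensor A (TensorProduct.comm k H H).toLinearMap
      ∘ₗ (TensorProduct.assoc k H H A).symm.toLinearMap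
  smul_mul : ρ ∘ₗ lTensor H (LinearMap.mul' k A) =
    LinearMap.mul' k A ∘ₗ TensorProduct.map ρ ρ
      ∘ₗ (TensorProduct.assoc k H A (H ⊗[k] A)).symm.toLinearMap
      ∘ₗ lTensor H ((TensorProduct.assoc k A H A).toLinearMap ∘ₗ rTensor A s
          ∘ₗ (TensorProduct.assoc k H A A).symm.toLinearMap)
      ∘ₗ (TensorProduct.assoc k H H (A ⊗[k] A)).toLinearMap
      ∘ₗ rTensor (A ⊗[k] A) (Coalgebra.comul (R := k))
  smul_one : ∀ h : H, ρ (h ⊗ₜ[k] (1 : A)) = Coalgebra.counit (R := k) h • (1 : A)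

/-- `M` is an `H`-bimodule via `ρl` and `ρr`. -/
structure IsBimodule (ρl : H ⊗[k] M →ₗ[k] M) (ρr : M ⊗[k] H →ₗ[k] M) : Prop where
  one_left : ∀ m : M, ρl ((1 : H) ⊗ₜ[k] m) = m
  mul_left : ρl ∘ₗ rTensor M (LinearMap.mul' k H) =
    ρl ∘ₗ lTensor H ρl ∘ₗ (TensorProduct.assoc k H H M).toLinearMap
  one_right : ∀ m : M, ρr (m ⊗ₜ[k] (1 : H)) = m
  mul_right : ρr ∘ₗ lTensor M (LinearMap.mul' k H) =
    ρr ∘ₗ rTensor H ρr ∘ₗ (TensorProduct.assoc k M H H).symm.toLinearMap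
  assoc : ρr ∘ₗ rTensor H ρl = ρl ∘ₗ lTensor H ρr ∘ₗ (TensorProduct.assoc k H M H).toLinearMap

/-- `φ : M⊗A → A⊗M` is a transposition of the `H`-bimodule `M` on `(A, s)`
(conditions (1)–(5) of Definition 5.2). -/
structure IsBimoduleTransposition (s : H ⊗[k] A →ₗ[k] A ⊗[k] H) (ρ : H ⊗[k] A →ₗ[k] A)
    (ρl : H ⊗[k] M →ₗ[k] M) (ρr : M ⊗[k] H →ₗ[k] M)
    (φ : M ⊗[k] A →ₗ[k] A ⊗[k] M) : Prop where
  one : ∀ m : M, φ (m ⊗ₜ[k] (1 : A)) = (1 : A) ⊗ₜ[k] m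
  mul : φ ∘ₗ lTensor M (LinearMap.mul' k A) =
    rTensor M (LinearMap.mul' k A) ∘ₗ (TensorProduct.assoc k A A M).symm.toLinearMap
      ∘ₗ lTensor A φ ∘ₗ (TensorProduct.assoc k A M A).toLinearMap
      ∘ₗ rTensor A φ ∘ₗ (TensorProduct.assoc k M A A).symm.toLinearMap
  action : φ ∘ₗ lTensor M ρ =
    rTensor M ρ ∘ₗ (TensorProduct.assoc k H A M).symm.toLinearMap ∘ₗ lTensor H φ
      ∘ₗ (TensorProduct.assoc k H M A).toLinearMap
      ∘ₗ rTensor A (TensorProduct.comm k M H).toLinearMap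
      ∘ₗ (TensorProduct.assoc k M H A).symm.toLinearMap
  s_compat : rTensor H φ ∘ₗ (TensorProduct.assoc k M A H).symm.toLinearMap
      ∘ₗ lTensor M s ∘ₗ (TensorProduct.assoc k M H A).toLinearMap
      ∘ₗ rTensor A (TensorProduct.comm k H M).toLinearMap
      ∘ₗ (TensorProduct.assoc k H M A).symm.toLinearMap =
    (TensorProduct.assoc k A M H).symm.toLinearMap
      ∘ₗ lTensor A (TensorProduct.comm k H M).toLinearMap
      ∘ₗ (TensorProduct.assoc k A H M).toLinearMap ∘ₗ rTensor M s
      ∘ₗ (TensorProduct.assoc k H A M).symm.toLinearMap ∘ₗ lTensor H φ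
  right_action : φ ∘ₗ rTensor A ρr =
    lTensor A ρr ∘ₗ (TensorProduct.assoc k A M H).toLinearMap ∘ₗ rTensor H φ
      ∘ₗ (TensorProduct.assoc k M A H).symm.toLinearMap
      ∘ₗ lTensor M s ∘ₗ (TensorProduct.assoc k M H A).toLinearMap
  left_action : φ ∘ₗ rTensor A ρl =
    lTensor A ρl ∘ₗ (TensorProduct.assoc k A H M).toLinearMap ∘ₗ rTensor M s
      ∘ₗ (TensorProduct.assoc k H A M).symm.toLinearMap
      ∘ₗ lTensor H φ ∘ₗ (TensorProduct.assoc k H M A).toLinearMap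

/-- Multiplying the first leg by `a` on the left commutes with `μ_A∘(A⊗f)`. -/
theorem mul'_lTensor_rTensor_mul' (f : M →ₗ[k] A) (a : A) (y : A ⊗[k] M) :
    LinearMap.mul' k A (lTensor A f (rTensor M (LinearMap.mul' k A)
      ((TensorProduct.assoc k A A M).symm (a ⊗ₜ[k] y)))) =
    a * LinearMap.mul' k A (lTensor A f y) := by
  induction y with
  | zero => simp
  | tmul b m => simp [mul_assoc]
  | add y z hy hz => simp only [tmul_add, map_add, mul_add, hy, hz]

/-- Proposition 5.6: if `f : M → Z(ˢA)` is an `H`-bimodule map and `V ⊆ M`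
is a subspace with `φ(V⊗A) ⊆ A⊗V`, then
`A_{f,V} = {a : f(v)·a = (μ_A∘(A⊗f)∘φ)(v⊗a) for all v ∈ V}` is a subalgebra of `A`. -/
theorem Afv_is_subalgebra
    (hcc : HopfCocomm k H)
    (s : H ⊗[k] A →ₗ[k] A ⊗[k] H) (hs : IsTransposition s)
    (ρ : H ⊗[k] A →ₗ[k] A) (hρ : IsModuleAlgebra s ρ)
    (ρl : H ⊗[k] M →ₗ[k] M) (ρr : M ⊗[k] H →ₗ[k] M) (hM : IsBimodule ρl ρr)
    (φ : M ⊗[k] A →ₗ[k] A ⊗[k] M) (hφ : IsBimoduleTransposition s ρ ρl ρr φ)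
    (f : M →ₗ[k] A)
    (hf_sA : ∀ (m : M) (h : H), s (h ⊗ₜ[k] f m) = f m ⊗ₜ[k] h)
    (hf_center : ∀ (m : M) (b : A), (∀ h : H, s (h ⊗ₜ[k] b) = b ⊗ₜ[k] h) →
        f m * b = b * f m)
    (hf_left : ∀ (h : H) (m : M), f (ρl (h ⊗ₜ[k] m)) = ρ (h ⊗ₜ[k] f m))
    (hf_right : ∀ (m : M) (h : H),
        f (ρr (m ⊗ₜ[k] h)) = Coalgebra.counit (R := k) h • f m)
    (V : Submodule k M)
    (hV : ∀ x ∈ Submodule.map φ (Submodule.span k {y : M ⊗[k] A | ∃ (v : M) (a : A),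
        v ∈ V ∧ y = v ⊗ₜ[k] a}), x ∈ Submodule.span k {y : A ⊗[k] M | ∃ (a : A) (v : M),
        v ∈ V ∧ y = a ⊗ₜ[k] v}) :
    ∃ S : Subalgebra k A, (S : Set A) =
      {a : A | ∀ v ∈ V, f v * a = LinearMap.mul' k A ((lTensor A f) (φ (v ⊗ₜ[k] a)))} := by
  have key : ∀ b : A,
      (∀ v ∈ V, f v * b = LinearMap.mul' k A ((lTensor A f) (φ (v ⊗ₜ[k] b)))) →
      ∀ x ∈ Submodule.span k {y : A ⊗[k] M | ∃ (a : A) (v : M), v ∈ V ∧ y = a ⊗ₜ[k] v},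
        LinearMap.mul' k A (lTensor A f x) * b =
          LinearMap.mul' k A (lTensor A f (rTensor M (LinearMap.mul' k A)
            ((TensorProduct.assoc k A A M).symm (lTensor A φ
              (TensorProduct.assoc k A M A (x ⊗ₜ[k] b)))))) := by
    intro b hb x hx
    induction hx using Submodule.span_induction with
    | mem x h =>
      obtain ⟨a, v, hv, rfl⟩ := h
      rw [assoc_tmul, lTensor_tmul, lTensor_tmul, mul'_lTensor_rTensor_mul', ← hb v hv,
        mul'_apply, mul_assoc]
    | zero => simp
    | add x y _ _ hx hy => simp only [add_tmul, map_add, add_mul, hx, hy]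
    | smul c x _ hx => simp only [← smul_tmul', map_smul, smul_mul_assoc, hx]
  refine ⟨{ carrier := {a : A | ∀ v ∈ V,
              f v * a = LinearMap.mul' k A ((lTensor A f) (φ (v ⊗ₜ[k] a)))}
            mul_mem' := ?_
            add_mem' := ?_
            algebraMap_mem' := ?_ }, rfl⟩
  · intro a b ha hb v hv
    have hφv : φ (v ⊗ₜ[k] (a * b)) = rTensor M (LinearMap.mul' k A)
        ((TensorProduct.assoc k A A M).symm (lTensor A φ
          (TensorProduct.assoc k A M A (φ (v ⊗ₜ[k] a) ⊗ₜ[k] b)))) := by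
      simpa using LinearMap.congr_fun hφ.mul (v ⊗ₜ[k] (a ⊗ₜ[k] b))
    rw [hφv, ← mul_assoc, ha v hv]
    exact key b hb _ (hV _ (Submodule.mem_map_of_mem (Submodule.subset_span ⟨v, a, hv, rfl⟩)))
  · intro a b ha hb v hv
    simp only [mul_add, tmul_add, map_add, ha v hv, hb v hv]
  · intro r v _
    simp [Algebra.algebraMap_eq_smul_one, hφ.one]
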